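/- (Weak convergence of compositions of frame operators.) Let d ≥ 3 and let f, g : ℝ^d → ℂ be smooth and compactly supported. Let λₙ > 0 and zₙ ∈ ℝ^d be sequences such that either λₙ → 0, or λₙ → ∞, or (λₙ → R for some R ∈ (0,∞) and |zₙ| → ∞). Then the rescaled functions hₙ = G_{λₙ,zₙ}f converge weakly to 0 in Ḣ¹ against g: ∫_{ℝ^d} ⟨∇hₙ(x), ∇g(x)⟩ dx → 0 as n → ∞, where ⟨·,·⟩ is the Hermitian inner product on ℂ^d. -/

import Mathlib

open ContDiff MeasureTheory Filter Topology

/-- The `j`-th partial derivative of a complex-valued function on `ℝ^d`. -/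
noncomputable def pdC {d : ℕ} (j : Fin d) (w : EuclideanSpace ℝ (Fin d) → ℂ)
    (x : EuclideanSpace ℝ (Fin d)) : ℂ :=
  fderiv ℝ w x (EuclideanSpace.single j 1)

/-- The dilation-translation operator `(G_{λ,z}f)(x) = λ^{(d−2)/2} f(λx + z)`. -/
noncomputable def Gop {d : ℕ} (lam : ℝ) (z : EuclideanSpace ℝ (Fin d))
    (f : EuclideanSpace ℝ (Fin d) → ℂ) (x : EuclideanSpace ℝ (Fin d)) : ℂ :=
  ((lam ^ (((d : ℝ) - 2) / 2) : ℝ) : ℂ) * f (lam • x + z)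

theorem aux_pd {d : ℕ} (j : Fin d) (f : EuclideanSpace ℝ (Fin d) → ℂ)
    (hf : Differentiable ℝ f) (l : ℝ) (hl : 0 < l) (z x : EuclideanSpace ℝ (Fin d)) :
    pdC j (Gop l z f) x = ((l ^ ((d : ℝ) / 2) : ℝ) : ℂ) * pdC j f (l • x + z) := by
  have h1 : HasFDerivAt (fun x : EuclideanSpace ℝ (Fin d) => l • x + z)
      (l • ContinuousLinearMap.id ℝ (EuclideanSpace ℝ (Fin d))) x :=
    ((hasFDerivAt_id x).const_smul l).add_const z
  have h2 := ((hf (l • x + z)).hasFDerivAt.comp x h1).const_mul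
    (((l ^ (((d : ℝ) - 2) / 2) : ℝ) : ℂ))
  have h3 : fderiv ℝ (Gop l z f) x = _ := h2.fderiv
  have e : l ^ ((d : ℝ) / 2) = l ^ (((d : ℝ) - 2) / 2) * l := by
    rw [← Real.rpow_add_one hl.ne']
    congr 1
    ring
  unfold pdC
  rw [h3, e]
  simp
  ring

theorem aux_tendsto (d : ℕ) (hd : 3 ≤ d)
    (F G : EuclideanSpace ℝ (Fin d) → ℂ)
    (hF : Continuous F) (hFc : HasCompactSupport F)
    (hG : Continuous G) (hGc : HasCompactSupport G)
    (lam : ℕ → ℝ) (hlam : ∀ n, 0 < lam n) (z : ℕ → EuclideanSpace ℝ (Fin d))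
    (hcase : Tendsto lam atTop (𝓝 0) ∨ Tendsto lam atTop atTop ∨
      (∃ R : ℝ, 0 < R ∧ Tendsto lam atTop (𝓝 R) ∧
        Tendsto (fun n => ‖z n‖) atTop atTop)) :
    Tendsto (fun n => ∫ x : EuclideanSpace ℝ (Fin d),
      (starRingEnd ℂ) (((lam n ^ ((d : ℝ) / 2) : ℝ) : ℂ) * F (lam n • x + z n)) * G x)
      atTop (𝓝 0) := by
  have hd0 : (0 : ℝ) < (d : ℝ) / 2 := by
    have : (3 : ℝ) ≤ d := by exact_mod_cast hd
    linarith
  obtain ⟨A, hA⟩ := hFc.exists_bound_of_continuous hF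
  obtain ⟨B, hB⟩ := hGc.exists_bound_of_continuous hG
  have hFi : Integrable F := hF.integrable_of_hasCompactSupport hFc
  have hGi : Integrable G := hG.integrable_of_hasCompactSupport hGc
  have hn : ∀ n x, ‖(starRingEnd ℂ) (((lam n ^ ((d : ℝ) / 2) : ℝ) : ℂ) *
      F (lam n • x + z n)) * G x‖ = lam n ^ ((d : ℝ) / 2) * ‖F (lam n • x + z n)‖ * ‖G x‖ := by
    intro n x
    rw [norm_mul, RCLike.norm_conj, norm_mul, Complex.norm_real, Real.norm_of_nonneg
      (Real.rpow_nonneg (hlam n).le _)]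
  rcases hcase with h | h | ⟨R, hR, h, hz⟩
  · have hb : ∀ n, ‖∫ x : EuclideanSpace ℝ (Fin d),
        (starRingEnd ℂ) (((lam n ^ ((d : ℝ) / 2) : ℝ) : ℂ) * F (lam n • x + z n)) * G x‖
        ≤ lam n ^ ((d : ℝ) / 2) * (A * ∫ x, ‖G x‖) := by
      intro n
      rw [← mul_assoc, ← integral_const_mul]
      refine norm_integral_le_of_norm_le (hGi.norm.const_mul _) (Eventually.of_forall fun x => ?_)
      rw [hn]
      have := Real.rpow_nonneg (hlam n).le ((d : ℝ) / 2)
      gcongr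
      exact hA _
    refine squeeze_zero_norm hb ?_
    have := (h.rpow_const (p := (d : ℝ) / 2) (Or.inr hd0.le)).mul_const (A * ∫ x, ‖G x‖)
    simpa [Real.zero_rpow hd0.ne'] using this
  · have hb : ∀ n, ‖∫ x : EuclideanSpace ℝ (Fin d),
        (starRingEnd ℂ) (((lam n ^ ((d : ℝ) / 2) : ℝ) : ℂ) * F (lam n • x + z n)) * G x‖
        ≤ lam n ^ (-((d : ℝ) / 2)) * (B * ∫ x, ‖F x‖) := by
      intro n
      have hl := hlam n
      have hi : Integrable (fun x => ‖F (lam n • x + z n)‖) :=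
        ((hFi.norm.comp_add_right (z n)).comp_smul hl.ne')
      have hval : ∫ x, ‖F (lam n • x + z n)‖ = (lam n ^ d)⁻¹ * ∫ x, ‖F x‖ := by
        rw [Measure.integral_comp_smul volume (fun y => ‖F (y + z n)‖) (lam n),
          integral_add_right_eq_self (fun y => ‖F y‖) (z n)]
        simp [abs_of_pos hl]
      have e : lam n ^ (-((d : ℝ) / 2)) = lam n ^ ((d : ℝ) / 2) * (lam n ^ d)⁻¹ := by
        rw [← Real.rpow_natCast, ← Real.rpow_neg hl.le, ← Real.rpow_add hl]
        congr 1
        ring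
      have e2 : lam n ^ (-((d : ℝ) / 2)) * (B * ∫ x, ‖F x‖) =
          ∫ x, (lam n ^ ((d : ℝ) / 2) * B) * ‖F (lam n • x + z n)‖ := by
        rw [integral_const_mul, hval, e]
        ring
      rw [e2]
      refine norm_integral_le_of_norm_le (hi.const_mul _) (Eventually.of_forall fun x => ?_)
      rw [hn, mul_right_comm]
      have := Real.rpow_nonneg (hlam n).le ((d : ℝ) / 2)
      gcongr
      exact hB _
    refine squeeze_zero_norm hb ?_
    have := ((tendsto_rpow_neg_atTop hd0).comp h).mul_const (B * ∫ x, ‖F x‖)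
    simpa using this
  · obtain ⟨a, ha⟩ := hFc.isCompact.isBounded.exists_norm_le
    obtain ⟨b, hb⟩ := hGc.isCompact.isBounded.exists_norm_le
    refine tendsto_const_nhds.congr' ?_
    filter_upwards [h.eventually_lt_const (lt_add_one R),
      hz.eventually_gt_atTop (a + (R + 1) * |b|)] with n h1 h2
    symm
    apply integral_eq_zero_of_ae
    refine Eventually.of_forall fun x => ?_
    by_cases hx : G x = 0
    · simp [hx]
    by_cases hy : F (lam n • x + z n) = 0
    · simp [hy]
    exfalso
    have i1 := hb x (subset_tsupport _ hx)
    have i2 := ha _ (subset_tsupport _ hy)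
    have i3 : ‖z n‖ ≤ ‖lam n • x + z n‖ + ‖lam n • x‖ := by
      have := norm_sub_le (lam n • x + z n) (lam n • x)
      simpa using this
    rw [norm_smul, Real.norm_of_nonneg (hlam n).le] at i3
    have i4 : lam n * ‖x‖ ≤ (R + 1) * |b| := by
      gcongr
      exact i1.trans (le_abs_self b)
    linarith

/-- Weak convergence to zero in `Ḣ¹` of compositions of frame operators. -/
theorem stmt17 (d : ℕ) (hd : 3 ≤ d)
    (f g : EuclideanSpace ℝ (Fin d) → ℂ)
    (hf : ContDiff ℝ ∞ f) (hfc : HasCompactSupport f)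
    (hg : ContDiff ℝ ∞ g) (hgc : HasCompactSupport g)
    (lam : ℕ → ℝ) (hlam : ∀ n, 0 < lam n) (z : ℕ → EuclideanSpace ℝ (Fin d))
    (hcase : Tendsto lam atTop (𝓝 0) ∨ Tendsto lam atTop atTop ∨
      (∃ R : ℝ, 0 < R ∧ Tendsto lam atTop (𝓝 R) ∧
        Tendsto (fun n => ‖z n‖) atTop atTop)) :
    Tendsto (fun n =>
        ∫ x : EuclideanSpace ℝ (Fin d),
          ∑ j : Fin d,
            (starRingEnd ℂ) (pdC j (Gop (lam n) (z n) f) x) * pdC j g x)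
      atTop (𝓝 0) := by
  have hfd : Differentiable ℝ f := hf.differentiable (by simp)
  have hc : ∀ (w : EuclideanSpace ℝ (Fin d) → ℂ), ContDiff ℝ ∞ w → ∀ j, Continuous (pdC j w) :=
    fun w hw j => (hw.continuous_fderiv (by simp)).clm_apply continuous_const
  have hs : ∀ (w : EuclideanSpace ℝ (Fin d) → ℂ), HasCompactSupport w →
      ∀ j, HasCompactSupport (pdC j w) :=
    fun w hw j => hw.fderiv_apply (𝕜 := ℝ) _
  have hsum := tendsto_finsetSum (Finset.univ : Finset (Fin d)) (fun j _ =>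
    aux_tendsto d hd (pdC j f) (pdC j g) (hc f hf j) (hs f hfc j) (hc g hg j) (hs g hgc j)
      lam hlam z hcase)
  simp only [Finset.sum_const_zero] at hsum
  refine hsum.congr fun n => ?_
  rw [← integral_finset_sum]
  · simp only [aux_pd _ f hfd (lam n) (hlam n)]
  · intro j _
    refine Continuous.integrable_of_hasCompactSupport ?_ ?_
    · have h1 := hc f hf j
      have h2 := hc g hg j
      refine (Complex.continuous_conj.comp (continuous_const.mul (h1.comp ?_))).mul h2
      fun_prop
    · exact (hs g hgc j).mul_left
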